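/- The torsion subgroup of the quotient of ℤ⁷ by the subgroup generated by the vectors (1,−1,−1,−1,0,0,0), (1,0,0,0,−1,−1,−1), (0,1,−1,0,0,0,0), (0,0,1,−1,0,0,0), (0,0,0,0,1,−1,0) and (0,0,0,0,0,1,−1) is isomorphic to ℤ/3ℤ. (This is the singularity type 3A₂.) -/

import Mathlib

abbrev qtN : Submodule ℤ (Fin 7 → ℤ) := Submodule.span ℤ ({![1,-1,-1,-1,0,0,0], ![1,0,0,0,-1,-1,-1], ![0,1,-1,0,0,0,0], ![0,0,1,-1,0,0,0], ![0,0,0,0,1,-1,0], ![0,0,0,0,0,1,-1]} : Set (Fin 7 → ℤ))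

def qtG : (Fin 7 → ℤ) →ₗ[ℤ] ZMod 3 :=
  AddMonoidHom.toIntLinearMap
    { toFun := fun x => ((x 4 + x 5 + x 6 : ℤ) : ZMod 3)
      map_zero' := by simp
      map_add' := by intro x y; simp only [Pi.add_apply]; push_cast; ring }

def qtH : (Fin 7 → ℤ) →ₗ[ℤ] ℤ :=
  AddMonoidHom.toIntLinearMap
    { toFun := fun x => 3 * x 0 + x 1 + x 2 + x 3 + x 4 + x 5 + x 6
      map_zero' := by simp
      map_add' := by intro x y; simp only [Pi.add_apply]; ring }

lemma qtG_apply (x : Fin 7 → ℤ) : qtG x = ((x 4 + x 5 + x 6 : ℤ) : ZMod 3) := rfl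
lemma qtH_apply (x : Fin 7 → ℤ) : qtH x = 3 * x 0 + x 1 + x 2 + x 3 + x 4 + x 5 + x 6 := rfl

lemma qtG_le : qtN ≤ LinearMap.ker qtG := by
  rw [Submodule.span_le]
  intro x hx
  simp only [Set.mem_insert_iff, Set.mem_singleton_iff] at hx
  rw [SetLike.mem_coe, LinearMap.mem_ker, qtG_apply]
  rcases hx with rfl | rfl | rfl | rfl | rfl | rfl <;> decide

lemma qtH_le : qtN ≤ LinearMap.ker qtH := by
  rw [Submodule.span_le]
  intro x hx
  simp only [Set.mem_insert_iff, Set.mem_singleton_iff] at hx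
  rw [SetLike.mem_coe, LinearMap.mem_ker, qtH_apply]
  rcases hx with rfl | rfl | rfl | rfl | rfl | rfl <;> decide

lemma qt_mem (x : Fin 7 → ℤ) (hg : qtG x = 0) (hh : qtH x = 0) : x ∈ qtN := by
  rw [qtG_apply, ZMod.intCast_zmod_eq_zero_iff_dvd] at hg
  rw [qtH_apply] at hh
  obtain ⟨k, hk⟩ := hg
  push_cast at hk
  have e : x = (x 0 + k) • ![1,-1,-1,-1,0,0,0] + (-k) • ![1,0,0,0,-1,-1,-1]
      + (x 1 + x 0 + k) • ![0,1,-1,0,0,0,0] + (-(x 0 + k) - x 3) • ![0,0,1,-1,0,0,0]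
      + (x 4 - k) • ![0,0,0,0,1,-1,0] + (k - x 6) • ![0,0,0,0,0,1,-1] := by
    ext i
    fin_cases i <;> simp <;> omega
  rw [e]
  refine add_mem (add_mem (add_mem (add_mem (add_mem ?_ ?_) ?_) ?_) ?_) ?_ <;>
    exact Submodule.smul_mem _ _ (Submodule.subset_span (by simp))

theorem quotient_torsion_eq :
    Nonempty
      ((AddCommGroup.torsion
        ((Fin 7 → ℤ) ⧸ Submodule.span ℤ ({![1,-1,-1,-1,0,0,0], ![1,0,0,0,-1,-1,-1], ![0,1,-1,0,0,0,0], ![0,0,1,-1,0,0,0], ![0,0,0,0,1,-1,0], ![0,0,0,0,0,1,-1]} : Set (Fin 7 → ℤ)))) ≃+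
        ZMod 3) := by
  let g := (qtN.liftQ qtG qtG_le).toAddMonoidHom
  let h := qtN.liftQ qtH qtH_le
  refine ⟨AddEquiv.ofBijective (g.comp (AddCommGroup.torsion ((Fin 7 → ℤ) ⧸ qtN)).subtype) ⟨?_, ?_⟩⟩
  · rw [injective_iff_map_eq_zero]
    rintro ⟨t, ht⟩ h0
    obtain ⟨x, rfl⟩ := Submodule.mkQ_surjective _ t
    have hg : qtG x = 0 := h0
    have ht' : IsOfFinAddOrder (qtN.mkQ x) := ht
    obtain ⟨n, hn, hx⟩ := isOfFinAddOrder_iff_nsmul_eq_zero.1 ht'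
    have h1 : h (n • qtN.mkQ x) = 0 := by rw [hx, map_zero]
    rw [map_nsmul] at h1
    have h2 : n • qtH x = 0 := h1
    have hh : qtH x = 0 := (smul_eq_zero.1 h2).resolve_left hn.ne'
    apply Subtype.ext
    exact (Submodule.Quotient.mk_eq_zero _).2 (qt_mem x hg hh)
  · intro z
    obtain ⟨m, rfl⟩ := ZMod.intCast_surjective z
    refine ⟨⟨qtN.mkQ ![0,-m,0,0,m,0,0], ?_⟩, ?_⟩
    · change IsOfFinAddOrder _
      refine isOfFinAddOrder_iff_nsmul_eq_zero.2 ⟨3, by norm_num, ?_⟩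
      rw [← map_nsmul]
      refine (Submodule.Quotient.mk_eq_zero _).2 (qt_mem _ ?_ ?_)
      · rw [map_nsmul, nsmul_eq_mul]
        have : ((3 : ℕ) : ZMod 3) = 0 := by decide
        rw [this, zero_mul]
      · rw [map_nsmul, qtH_apply]; simp
    · change qtG _ = _
      rw [qtG_apply]; simp
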